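/- Corollary 4.2: Suppose the invariant primary tori T₁ and T₂ bound a Birkhoff Zone of Instability Z, and that the restriction of f to each of T₁ and T₂ is topologically transitive in the quotient annulus (i.e. the induced map on the quotient circle T_i/΄(x ~ x+1) has a dense orbit, for i = 1,2). Then for every ζ₁ ∈ T₁, ζ₂ ∈ T₂ and every pair of open neighborhoods U of ζ₁ and V of ζ₂ in A, there exist a point z ∈ U, an integer N > 0, and an integer j such that f^N(z) ∈ V + (j,0). -/

import Mathlib

open Set Filter Topology

noncomputable section

/-- The closed annulus `A = ℝ × [0,1]` (universal cover of `𝕋¹ × [0,1]`). -/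
def Ann : Set (ℝ × ℝ) := {p | p.2 ∈ Set.Icc (0:ℝ) 1}

/-- An area-preserving positive monotone twist map of the annulus, given together with
its inverse, as a lift to the universal cover `A = ℝ × [0,1]`. -/
structure AnnulusTwistMap where
  f : ℝ × ℝ → ℝ × ℝ
  finv : ℝ × ℝ → ℝ × ℝ
  smooth : ContDiffOn ℝ 1 f Ann
  smooth_inv : ContDiffOn ℝ 1 finv Ann
  maps : Set.MapsTo f Ann Ann
  maps_inv : Set.MapsTo finv Ann Ann
  left_inv : ∀ p ∈ Ann, finv (f p) = p
  right_inv : ∀ p ∈ Ann, f (finv p) = p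
  lift : ∀ p ∈ Ann, f (p.1 + 1, p.2) = f p + (1, 0)
  orient : ∀ p ∈ Ann, 0 < LinearMap.det ((fderivWithin ℝ f Ann p).toLinearMap)
  bottom : ∀ x : ℝ, (f (x, 0)).2 = 0
  top : ∀ x : ℝ, (f (x, 1)).2 = 1
  area : ∀ s ⊆ Ann, MeasurableSet s → MeasureTheory.volume (f '' s) = MeasureTheory.volume s
  twist : ∀ p ∈ Ann, 0 < derivWithin (fun y => (f (p.1, y)).1) (Set.Icc (0:ℝ) 1) p.2

/-- The graph `{(x, φ(x)) : x ∈ ℝ}` of a function `φ`. -/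
def torusGraph (φ : ℝ → ℝ) : Set (ℝ × ℝ) := {p | p.2 = φ p.1}

/-- `φ` defines an invariant primary torus (essential invariant circle) for `F`. -/
def IsPrimaryTorusFn (F : AnnulusTwistMap) (φ : ℝ → ℝ) : Prop :=
  (∃ K, LipschitzWith K φ) ∧ (∀ x, φ x ∈ Set.Icc (0:ℝ) 1) ∧ (∀ x, φ (x + 1) = φ x) ∧
    F.f '' torusGraph φ = torusGraph φ

/-- `T` is an invariant primary torus for `F`. -/
def IsPrimaryTorus (F : AnnulusTwistMap) (T : Set (ℝ × ℝ)) : Prop :=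
  ∃ φ, IsPrimaryTorusFn F φ ∧ T = torusGraph φ

/-- The closed region between the graphs of `φ₁` and `φ₂`. -/
def zone (φ₁ φ₂ : ℝ → ℝ) : Set (ℝ × ℝ) := {p | φ₁ p.1 ≤ p.2 ∧ p.2 ≤ φ₂ p.1}

/-- The open region strictly between the graphs of `φ₁` and `φ₂` (the interior of the zone). -/
def zoneInterior (φ₁ φ₂ : ℝ → ℝ) : Set (ℝ × ℝ) := {p | φ₁ p.1 < p.2 ∧ p.2 < φ₂ p.1}

/-- The region between the invariant primary tori `graph φ₁` and `graph φ₂` is a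
Birkhoff Zone of Instability. -/
def IsBZI (F : AnnulusTwistMap) (φ₁ φ₂ : ℝ → ℝ) : Prop :=
  IsPrimaryTorusFn F φ₁ ∧ IsPrimaryTorusFn F φ₂ ∧ (∀ x, φ₁ x < φ₂ x) ∧
    ∀ T, IsPrimaryTorus F T → ¬ T ⊆ zoneInterior φ₁ φ₂

/-- `z` has rotation number `ω`. -/
def HasRotNum (F : AnnulusTwistMap) (z : ℝ × ℝ) (ω : ℝ) : Prop :=
  Filter.Tendsto (fun n : ℕ => ((F.f)^[n] z).1 / n) Filter.atTop (nhds ω)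

/-- The `n`-th iterate of `F` for `n : ℤ`. -/
def iterZ (F : AnnulusTwistMap) (n : ℤ) (z : ℝ × ℝ) : ℝ × ℝ :=
  if 0 ≤ n then (F.f)^[n.toNat] z else (F.finv)^[(-n).toNat] z

/-- The extended orbit `EO(z) = {fⁿ(z) + (j,0) : n, j ∈ ℤ}`. -/
def extOrbit (F : AnnulusTwistMap) (z : ℝ × ℝ) : Set (ℝ × ℝ) :=
  {w | ∃ n j : ℤ, w = iterZ F n z + ((j : ℝ), 0)}

/-- A monotone (cyclically ordered) set. -/
def IsMonotoneSet (F : AnnulusTwistMap) (M : Set (ℝ × ℝ)) : Prop :=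
  ∀ z₁ ∈ M, ∀ z₂ ∈ M, z₁.1 < z₂.1 → (F.f z₁).1 < (F.f z₂).1

/-- An Aubry-Mather set of rotation number `ω`: a nonempty, closed, invariant, monotone,
minimal subset of `Rot(ω)`. -/
def IsAubryMather (F : AnnulusTwistMap) (ω : ℝ) (S : Set (ℝ × ℝ)) : Prop :=
  S.Nonempty ∧ IsClosed S ∧ F.f '' S = S ∧ IsMonotoneSet F S ∧
    (∀ z ∈ S, HasRotNum F z ω) ∧
    ∀ S' ⊆ S, S'.Nonempty → IsClosed S' → F.f '' S' = S' → S' = S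

/-- The restriction of `F` to the invariant primary torus `graph φ` is topologically
transitive in the quotient annulus: some forward orbit is dense modulo the integer
translations `(j,0)`. -/
def TransitiveOnTorus (F : AnnulusTwistMap) (φ : ℝ → ℝ) : Prop :=
  ∃ p ∈ torusGraph φ, ∀ q ∈ torusGraph φ, ∀ ε > (0:ℝ), ∃ n : ℕ, ∃ j : ℤ,
    dist ((F.f)^[n] p + ((j : ℝ), 0)) q < ε

namespace CircleDeg1Lift

variable (G : CircleDeg1Lift)

/-- The lift `x ↦ G^q x + j`. -/
def iterAdd (q : ℕ) (j : ℤ) : CircleDeg1Lift :=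
  translate (Multiplicative.ofAdd (j : ℝ)) * G ^ q

lemma iterAdd_apply (q : ℕ) (j : ℤ) (x : ℝ) : G.iterAdd q j x = j + G^[q] x := by
  simp [iterAdd, coe_pow]

lemma iterate_add_int (n : ℕ) (x : ℝ) (j : ℤ) : G^[n] (x + j) = G^[n] x + j := by
  rw [← coe_pow, map_add_int]

lemma continuous_iterAdd (hG : Continuous G) (q : ℕ) (j : ℤ) : Continuous (G.iterAdd q j) := by
  have : ⇑(G.iterAdd q j) = fun x => (j : ℝ) + G^[q] x := funext (G.iterAdd_apply q j)
  rw [this]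
  exact continuous_const.add (hG.iterate q)

lemma iterate_iterAdd (q : ℕ) (j : ℤ) (k : ℕ) (x : ℝ) :
    (G.iterAdd q j)^[k] x = G^[q * k] x + ((k * j : ℤ) : ℝ) := by
  induction k with
  | zero => simp
  | succ k ih =>
    rw [Function.iterate_succ_apply', ih, iterAdd_apply, iterate_add_int,
      ← Function.iterate_add_apply, mul_add, mul_one, add_comm q]
    push_cast
    ring

/-- A lift with an orbit that is dense modulo the integers has no periodic points modulo the
integers. -/
lemma iterAdd_ne_self_of_dense (hG : Continuous G) (x₀ : ℝ)
    (hd : ∀ y, ∀ ε > (0 : ℝ), ∃ n : ℕ, ∃ j : ℤ, |G^[n] x₀ + j - y| < ε)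
    {q : ℕ} (hq : 0 < q) (j : ℤ) (l : ℝ) : G.iterAdd q j l ≠ l := by
  intro hl
  set H := G.iterAdd q j with hH
  have hfix : ∀ i : ℤ, H (l + i) = l + i := fun i => by rw [map_add_int, hl]
  have hit : ∀ (k : ℕ) (i : ℤ), H^[k] (l + i) = l + i := fun k i =>
    Function.iterate_fixed (hfix i) k
  have hlo : l + (⌊x₀ - l⌋ : ℤ) ≤ x₀ := by linarith [Int.floor_le (x₀ - l)]
  have hhi : x₀ ≤ l + (⌈x₀ - l⌉ : ℤ) := by linarith [Int.le_ceil (x₀ - l)]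
  obtain ⟨L, hL⟩ : ∃ L, Tendsto (fun k => H^[k] x₀) atTop (𝓝 L) := by
    rcases le_total x₀ (H x₀) with h | h
    · refine ⟨_, tendsto_atTop_ciSup (H.monotone.monotone_iterate_of_le_map h)
        ⟨l + (⌈x₀ - l⌉ : ℤ), ?_⟩⟩
      rintro _ ⟨k, rfl⟩
      simpa only [hit] using H.monotone.iterate k hhi
    · refine ⟨_, tendsto_atTop_ciInf (H.monotone.antitone_iterate_of_map_le h)
        ⟨l + (⌊x₀ - l⌋ : ℤ), ?_⟩⟩
      rintro _ ⟨k, rfl⟩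
      simpa only [hit] using H.monotone.iterate k hlo
  let π : ℝ → AddCircle (1 : ℝ) := fun x => (x : AddCircle (1 : ℝ))
  have hπ : Continuous π := AddCircle.continuous_mk' 1
  have hπint : ∀ (x : ℝ) (i : ℤ), π (x + i) = π x := fun x i => by
    simp only [π, AddCircle.coe_add]
    have : ((i : ℝ) : AddCircle (1 : ℝ)) = 0 :=
      (AddCircle.coe_eq_zero_iff 1).2 ⟨i, by simp⟩
    rw [this, add_zero]
  let K : Fin q → Set (AddCircle (1 : ℝ)) := fun r =>
    insert (π (G^[r] L)) (range fun k => π (G^[r] (H^[k] x₀)))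
  have hKc : ∀ r, IsCompact (K r) := fun r =>
    (((hπ.comp (hG.iterate r)).tendsto L).comp hL).isCompact_insert_range
  have hKcount : (⋃ r, K r).Countable :=
    countable_iUnion fun r => (countable_range _).insert _
  have hclosed : IsClosed (⋃ r, K r) := isClosed_iUnion_of_finite fun r => (hKc r).isClosed
  have horb : ∀ n, π (G^[n] x₀) ∈ ⋃ r, K r := by
    intro n
    refine mem_iUnion.2 ⟨⟨n % q, Nat.mod_lt _ hq⟩, Or.inr ⟨n / q, ?_⟩⟩
    simp only [hH, iterate_iterAdd, iterate_add_int, hπint]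
    rw [← Function.iterate_add_apply, Nat.mod_add_div]
  have huniv : (⋃ r, K r) = univ := by
    rw [← hclosed.closure_eq, eq_univ_iff_forall]
    intro y
    obtain ⟨y, rfl⟩ : ∃ z, π z = y := QuotientAddGroup.mk_surjective y
    have : y ∈ closure (π ⁻¹' ⋃ r, K r) := by
      rw [Metric.mem_closure_iff]
      intro ε hε
      obtain ⟨n, i, hn⟩ := hd y ε hε
      refine ⟨_, ?_, by rw [dist_comm, Real.dist_eq]; exact hn⟩
      rw [mem_preimage, hπint]
      exact horb n
    exact closure_mono (image_preimage_subset _ _)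
      (image_closure_subset_closure_image hπ ⟨y, this, rfl⟩)
  rw [huniv] at hKcount
  have : Countable (AddCircle (1 : ℝ)) := countable_univ_iff.1 hKcount
  have : Countable (Ico (0 : ℝ) (0 + 1)) := (AddCircle.equivIco 1 0).symm.injective.countable
  exact absurd (countable_coe_iff.1 this) (by
    rw [← Cardinal.le_aleph0_iff_set_countable, Cardinal.mk_Ico_real (by norm_num)]
    exact not_le.2 Cardinal.aleph0_lt_continuum)

end CircleDeg1Lift

/-- If an increasing continuous map without fixed points moves `u` to the right, then the iterates
of `[u, h u]` cover everything to the right of `h u`. -/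
lemma exists_iterate_eq_of_lt_map {h : ℝ → ℝ} (hm : Monotone h) (hc : Continuous h)
    (hne : ∀ x, h x ≠ x) {u : ℝ} (hu : u < h u) {X : ℝ} (hX : h u ≤ X) :
    ∃ k : ℕ, 0 < k ∧ ∃ v ∈ Icc u (h u), h^[k] v = X := by
  have hmono := hm.monotone_iterate_of_le_map hu.le
  have hex : ∃ k, X < h^[k] u := by
    by_contra! hb
    have hl := tendsto_atTop_ciSup hmono ⟨X, by rintro _ ⟨k, rfl⟩; exact hb k⟩
    exact hne _ (isFixedPt_of_tendsto_iterate hl hc.continuousAt)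
  classical
  obtain ⟨k, hk⟩ : ∃ k, Nat.find hex = k + 2 := by
    refine Nat.exists_eq_add_of_le' ?_
    by_contra! hlt
    have h1 : h^[1] u ≤ X := hX
    have := hmono (show Nat.find hex ≤ 1 by omega)
    exact absurd (Nat.find_spec hex) (not_lt.2 (le_trans this h1))
  refine ⟨k + 1, k.succ_pos, ?_⟩
  have h1 : h^[k + 1] u ≤ X := not_lt.1 (Nat.find_min hex (by omega))
  have h2 : X ≤ h^[k + 1] (h u) := by
    rw [← Function.iterate_succ_apply]
    have := Nat.find_spec hex
    rw [hk] at this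
    exact this.le
  exact intermediate_value_Icc hu.le (hc.iterate (k + 1)).continuousOn ⟨h1, h2⟩

namespace CircleDeg1Lift

variable (G : CircleDeg1Lift)

/-- If some forward orbit of a lift is dense modulo the integers, then so is every backward
orbit. -/
lemma exists_iterate_eq_of_dense (hG : Continuous G) (x₀ : ℝ)
    (hd : ∀ y, ∀ ε > (0 : ℝ), ∃ n : ℕ, ∃ j : ℤ, |G^[n] x₀ + j - y| < ε)
    (x : ℝ) {a b : ℝ} (hab : a < b) :
    ∃ n : ℕ, 0 < n ∧ ∃ j : ℤ, ∃ u ∈ Ioo a b, G^[n] u = x + j := by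
  wlog hb : b ≤ a + 1 generalizing b
  · obtain ⟨n, hn, j, u, hu, e⟩ := this (b := min b (a + 1)) (by simp [hab]) (min_le_right _ _)
    exact ⟨n, hn, j, u, ⟨hu.1, hu.2.trans_le (min_le_left _ _)⟩, e⟩
  have visit : ∀ c d, c < d → ∃ n : ℕ, ∃ j : ℤ, G^[n] x₀ + j ∈ Ioo c d := by
    intro c d hcd
    obtain ⟨n, j, h⟩ := hd ((c + d) / 2) ((d - c) / 2) (by linarith)
    rw [abs_lt] at h
    exact ⟨n, j, by linarith, by linarith⟩
  obtain ⟨n, i, hi⟩ := visit a b hab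
  obtain ⟨m, j, hj⟩ := visit a (G^[n] x₀ + i) hi.1
  have hmn : m ≠ n := by
    rintro rfl
    have h1 : (j : ℝ) < i := by linarith [hj.2]
    have h2 : (i : ℝ) < j + 1 := by linarith [hi.2, hj.1]
    norm_cast at h1 h2
    omega
  obtain ⟨q, hq, k, u, hu, hw⟩ : ∃ q : ℕ, 0 < q ∧ ∃ k : ℤ, ∃ u ∈ Ioo a b,
      G.iterAdd q k u ∈ Ioo a b := by
    have key : ∀ (n m : ℕ) (i j : ℤ), n < m → G^[n] x₀ + i ∈ Ioo a b → G^[m] x₀ + j ∈ Ioo a b →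
        ∃ q : ℕ, 0 < q ∧ ∃ k : ℤ, ∃ u ∈ Ioo a b, G.iterAdd q k u ∈ Ioo a b := by
      intro n m i j hlt h1 h2
      refine ⟨m - n, by omega, j - i, _, h1, ?_⟩
      rw [iterAdd_apply, iterate_add_int, ← Function.iterate_add_apply,
        Nat.sub_add_cancel hlt.le]
      convert h2 using 1
      push_cast
      ring
    have hj' : G^[m] x₀ + j ∈ Ioo a b := ⟨hj.1, hj.2.trans hi.2⟩
    rcases lt_or_gt_of_ne hmn with h | h
    · exact key m n j i h hj' hi
    · exact key n m i j h hi hj'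
  set H := G.iterAdd q k with hH
  have hne : ∀ y, H y ≠ y := G.iterAdd_ne_self_of_dense hG x₀ hd hq k
  have hc : Continuous H := G.continuous_iterAdd hG q k
  suffices ∃ l : ℕ, 0 < l ∧ ∃ j : ℤ, ∃ v ∈ Ioo a b, H^[l] v = x + j by
    obtain ⟨l, hl, j, v, hv, e⟩ := this
    rw [hH, iterate_iterAdd] at e
    refine ⟨q * l, Nat.mul_pos hq hl, j - l * k, v, hv, ?_⟩
    push_cast at e ⊢
    linarith
  rcases lt_or_gt_of_ne (hne u) with h | h
  · obtain ⟨l, hl, v, hv, e⟩ := exists_iterate_eq_of_lt_map (h := fun y => -H (-y)) (u := -u)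
      (X := -(x + (⌊H u - x⌋ : ℤ))) (fun s t hst => neg_le_neg (H.monotone (neg_le_neg hst)))
      (hc.comp continuous_neg).neg
      (fun y hy => hne (-y) (by linarith)) (by simpa using h)
      (by simp only [neg_neg]; linarith [Int.floor_le (H u - x)])
    simp only [neg_neg, mem_Icc] at hv
    refine ⟨l, hl, ⌊H u - x⌋, -v, ⟨by linarith [hw.1], by linarith [hu.2]⟩, ?_⟩
    have hs : Function.Semiconj (fun y : ℝ => -y) (fun y => -H (-y)) H := fun y => by simp
    rw [← (hs.iterate_right l).eq v, e, neg_neg]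
  · obtain ⟨l, hl, v, hv, e⟩ := exists_iterate_eq_of_lt_map H.monotone hc hne h
      (X := x + (⌈H u - x⌉ : ℤ)) (by linarith [Int.le_ceil (H u - x)])
    exact ⟨l, hl, _, v, ⟨hu.1.trans_le hv.1, hv.2.trans_lt hw.2⟩, e⟩

/-- The lift determined by an injective continuous map commuting with the unit translation. -/
def ofInjective (b : ℝ → ℝ) (hc : Continuous b) (hi : Function.Injective b)
    (h1 : ∀ x, b (x + 1) = b x + 1) : CircleDeg1Lift where
  toFun := b
  monotone' := by
    rcases hc.strictMono_of_inj hi with h | h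
    · exact h.monotone
    · exact absurd (h (show (0 : ℝ) < 0 + 1 by norm_num)) (by rw [h1]; linarith)
  map_add_one' := h1

end CircleDeg1Lift

lemma isClosed_Ann : IsClosed Ann := isClosed_Icc.preimage continuous_snd

/-- A pair of mutually inverse bi-Lipschitz maps of the annulus preserving its boundary components,
such that `f` twists uniformly to the right and `g` to the left. -/
structure IsTwistPair (f g : ℝ × ℝ → ℝ × ℝ) (c C : ℝ) : Prop where
  c_pos : 0 < c
  C_nonneg : 0 ≤ C
  maps : MapsTo f Ann Ann
  maps_inv : MapsTo g Ann Ann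
  left_inv : ∀ p ∈ Ann, g (f p) = p
  right_inv : ∀ p ∈ Ann, f (g p) = p
  lip : ∀ p ∈ Ann, ∀ q ∈ Ann, dist (f p) (f q) ≤ C * dist p q
  lip_inv : ∀ p ∈ Ann, ∀ q ∈ Ann, dist (g p) (g q) ≤ C * dist p q
  twist : ∀ x y y', 0 ≤ y → y ≤ y' → y' ≤ 1 → c * (y' - y) ≤ (f (x, y')).1 - (f (x, y)).1
  twist_inv : ∀ x y y', 0 ≤ y → y ≤ y' → y' ≤ 1 → c * (y' - y) ≤ (g (x, y)).1 - (g (x, y')).1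
  bot : ∀ x, (f (x, 0)).2 = 0
  bot_inv : ∀ x, (g (x, 0)).2 = 0
  top : ∀ x, (f (x, 1)).2 = 1
  top_inv : ∀ x, (g (x, 1)).2 = 1
  bot_mono : Monotone fun x => (f (x, 0)).1
  bot_mono_inv : Monotone fun x => (g (x, 0)).1

/-- The reflection of the plane in the vertical axis. -/
def reflect (p : ℝ × ℝ) : ℝ × ℝ := (-p.1, p.2)

lemma reflect_reflect (p : ℝ × ℝ) : reflect (reflect p) = p := by simp [reflect]

lemma reflect_mem_Ann {p : ℝ × ℝ} : reflect p ∈ Ann ↔ p ∈ Ann := Iff.rfl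

lemma dist_reflect (p q : ℝ × ℝ) : dist (reflect p) (reflect q) = dist p q := by
  simp [reflect, Prod.dist_eq, dist_neg_neg]

/-- A region that contains, together with a point, everything to its left and below the ray of
slope `K` through it, down to the bottom of the annulus. -/
def DownLeftClosed (K : ℝ) (L : Set (ℝ × ℝ)) : Prop :=
  ∀ x x' y y', (x', y') ∈ L → x ≤ x' → 0 ≤ y → y + K * (x' - x) ≤ y' → (x, y) ∈ L

/-- The upper boundary of `L`. -/
def topSet (L : Set (ℝ × ℝ)) : Set (ℝ × ℝ) := {p | p ∈ L ∧ ∀ y, (p.1, y) ∈ L → y ≤ p.2}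

/-- A region that contains, together with a point, the vertical segment below it. -/
def IsLowerRegion (L : Set (ℝ × ℝ)) : Prop :=
  ∀ x y y', (x, y') ∈ L → 0 ≤ y → y ≤ y' → (x, y) ∈ L

lemma DownLeftClosed.isLowerRegion {K : ℝ} {L : Set (ℝ × ℝ)} (h : DownLeftClosed K L) :
    IsLowerRegion L :=
  fun x y y' hy' hy hle => h x x y y' hy' le_rfl hy (by simpa using hle)

/-- The region below the image of `L`. -/
def shadow (f : ℝ × ℝ → ℝ × ℝ) (L : Set (ℝ × ℝ)) : Set (ℝ × ℝ) :=
  {p | 0 ≤ p.2 ∧ ∃ y, p.2 ≤ y ∧ (p.1, y) ∈ f '' L}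

namespace IsTwistPair

variable {f g : ℝ × ℝ → ℝ × ℝ} {c C : ℝ}

lemma mirrored (h : IsTwistPair f g c C) :
    IsTwistPair (fun p => reflect (g (reflect p))) (fun p => reflect (f (reflect p))) c C where
  c_pos := h.c_pos
  C_nonneg := h.C_nonneg
  maps := fun p hp => h.maps_inv hp
  maps_inv := fun p hp => h.maps hp
  left_inv := fun p hp => by
    simp only [reflect_reflect, h.right_inv _ (reflect_mem_Ann.2 hp)]
  right_inv := fun p hp => by
    simp only [reflect_reflect, h.left_inv _ (reflect_mem_Ann.2 hp)]
  lip := fun p hp q hq => by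
    simpa only [dist_reflect] using h.lip_inv _ (reflect_mem_Ann.2 hp) _ (reflect_mem_Ann.2 hq)
  lip_inv := fun p hp q hq => by
    simpa only [dist_reflect] using h.lip _ (reflect_mem_Ann.2 hp) _ (reflect_mem_Ann.2 hq)
  twist := fun x y y' h0 hy h1 => by
    have := h.twist_inv (-x) y y' h0 hy h1
    simp only [reflect]; linarith
  twist_inv := fun x y y' h0 hy h1 => by
    have := h.twist (-x) y y' h0 hy h1
    simp only [reflect]; linarith
  bot := fun x => h.bot_inv (-x)
  bot_inv := fun x => h.bot (-x)
  top := fun x => h.top_inv (-x)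
  top_inv := fun x => h.top (-x)
  bot_mono := fun _ _ hx => neg_le_neg (h.bot_mono_inv (neg_le_neg hx))
  bot_mono_inv := fun _ _ hx => neg_le_neg (h.bot_mono (neg_le_neg hx))

lemma continuousOn (h : IsTwistPair f g c C) : ContinuousOn f Ann :=
  (LipschitzOnWith.of_dist_le_mul (K := ⟨C, h.C_nonneg⟩) h.lip).continuousOn

lemma continuousOn_inv (h : IsTwistPair f g c C) : ContinuousOn g Ann :=
  (LipschitzOnWith.of_dist_le_mul (K := ⟨C, h.C_nonneg⟩) h.lip_inv).continuousOn

lemma mem_image (h : IsTwistPair f g c C) {L : Set (ℝ × ℝ)} (hL : L ⊆ Ann) {p : ℝ × ℝ} :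
    p ∈ f '' L ↔ p ∈ Ann ∧ g p ∈ L := by
  constructor
  · rintro ⟨q, hq, rfl⟩
    exact ⟨h.maps (hL hq), by rwa [h.left_inv q (hL hq)]⟩
  · rintro ⟨hp, hg⟩
    exact ⟨g p, hg, h.right_inv p hp⟩

lemma image_subset_shadow (h : IsTwistPair f g c C) {L : Set (ℝ × ℝ)} (hL : L ⊆ Ann) :
    f '' L ⊆ shadow f L := fun p hp =>
  ⟨((h.mem_image hL).1 hp).1.1, p.2, le_rfl, hp⟩

lemma shadow_subset (h : IsTwistPair f g c C) {L : Set (ℝ × ℝ)} (hL : L ⊆ Ann) :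
    shadow f L ⊆ Ann := fun _ hp => by
  obtain ⟨h0, y, hy, hm⟩ := hp
  exact ⟨h0, hy.trans ((h.mem_image hL).1 hm).1.2⟩

lemma isClosed_image (h : IsTwistPair f g c C) {L : Set (ℝ × ℝ)} (hL : L ⊆ Ann)
    (hc : IsClosed L) : IsClosed (f '' L) := by
  have : f '' L = Ann ∩ g ⁻¹' L := by
    ext p
    exact h.mem_image hL
  rw [this]
  exact h.continuousOn_inv.preimage_isClosed_of_isClosed isClosed_Ann hc

lemma isClosed_shadow (h : IsTwistPair f g c C) {L : Set (ℝ × ℝ)} (hL : L ⊆ Ann)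
    (hc : IsClosed L) : IsClosed (shadow f L) := by
  have hcl := h.isClosed_image hL hc
  let S : Set ((ℝ × ℝ) × Icc (0 : ℝ) 1) :=
    {q | 0 ≤ q.1.2 ∧ q.1.2 ≤ q.2 ∧ (q.1.1, (q.2 : ℝ)) ∈ f '' L}
  have hS : IsClosed S := by
    refine IsClosed.and (isClosed_le continuous_const (by fun_prop)) (IsClosed.and ?_ ?_)
    · exact isClosed_le (f := fun q : (ℝ × ℝ) × Icc (0 : ℝ) 1 => q.1.2)
        (g := fun q => (q.2 : ℝ)) (by fun_prop) (by fun_prop)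
    · exact hcl.preimage (f := fun q : (ℝ × ℝ) × Icc (0 : ℝ) 1 => (q.1.1, (q.2 : ℝ)))
        (by fun_prop)
  convert isClosedMap_fst_of_compactSpace S hS
  ext p
  constructor
  · rintro ⟨h0, y, hy, hm⟩
    exact ⟨(p, ⟨y, ((h.mem_image hL).1 hm).1⟩), ⟨h0, hy, hm⟩, rfl⟩
  · rintro ⟨⟨p, y⟩, ⟨h0, hy, hm⟩, rfl⟩
    exact ⟨h0, y, hy, hm⟩

/-- The shadow of a lower region cannot rise steeply to the right. -/
lemma downLeftClosed_shadow (h : IsTwistPair f g c C) {L : Set (ℝ × ℝ)} (hL : L ⊆ Ann)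
    (hlow : IsLowerRegion L) : DownLeftClosed (C / c) (shadow f L) := by
  rintro x x' y y' ⟨-, y'', hy'', hm⟩ hx h0 hy
  dsimp only at hy'' hm
  obtain ⟨hA, hg⟩ := (h.mem_image hL).1 hm
  have hx0 : 0 ≤ x' - x := sub_nonneg.2 hx
  have hKx : 0 ≤ C / c * (x' - x) := mul_nonneg (div_nonneg h.C_nonneg h.c_pos.le) hx0
  have hyy : y + C / c * (x' - x) ≤ y'' := hy.trans hy''
  have hyA : (x, y) ∈ Ann := ⟨h0, by linarith [hA.2]⟩
  have hgA := h.maps_inv hA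
  have hab : (g (x', y'')).1 ≤ (g (x, y)).1 := by
    have h1 := h.twist_inv x y y'' h0 (by linarith) hA.2
    have h2 := h.lip_inv (x', y'') hA (x, y'') hA
    have h3 : (g (x', y'')).1 - (g (x, y'')).1 ≤ dist (g (x', y'')) (g (x, y'')) :=
      (le_abs_self _).trans (le_max_left _ _)
    have h4 : dist (x', y'') (x, y'') = x' - x := by
      simp [Prod.dist_eq, Real.dist_eq, abs_of_nonneg hx0, hx]
    rw [h4] at h2
    have h5 : C * (x' - x) ≤ c * (y'' - y) := by
      have := mul_le_mul_of_nonneg_left hyy h.c_pos.le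
      rw [mul_add, ← mul_assoc, mul_div_cancel₀ _ h.c_pos.ne'] at this
      linarith
    linarith
  set a' := (g (x', y'')).1 with ha'
  set b' := (g (x', y'')).2 with hb'
  have hq' : g (x', y'') = (a', b') := rfl
  rw [hq'] at hg
  have hb0 : 0 ≤ b' := hgA.1
  have hb1 : b' ≤ 1 := hgA.2
  have hf' : f (a', b') = (x', y'') := by rw [← hq', h.right_inv _ hA]
  have hleft : (f (a', 0)).1 ≤ x := by
    have h1 := h.bot_mono hab
    have hgyA := h.maps_inv hyA
    have h2 := h.twist (g (x, y)).1 0 (g (x, y)).2 le_rfl hgyA.1 hgyA.2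
    have h3 := mul_nonneg h.c_pos.le (sub_nonneg.2 hgyA.1)
    have h4 : f ((g (x, y)).1, (g (x, y)).2) = (x, y) := h.right_inv _ hyA
    rw [h4] at h2
    dsimp only at h1 h2 ⊢
    linarith
  have hcont : ContinuousOn (fun t => (f (a', t)).1) (Icc 0 b') :=
    continuous_fst.comp_continuousOn (h.continuousOn.comp (by fun_prop)
      fun t ht => ⟨ht.1, ht.2.trans hb1⟩)
  obtain ⟨t, ht, hft⟩ := intermediate_value_Icc hb0 hcont
    (show x ∈ Icc (f (a', 0)).1 (f (a', b')).1 from ⟨hleft, by rw [hf']; exact hx⟩)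
  have htA : (a', t) ∈ Ann := ⟨ht.1, ht.2.trans hb1⟩
  have hf : f (a', t) = (x, (f (a', t)).2) := Prod.ext hft rfl
  refine ⟨h0, (f (a', t)).2, ?_, ?_⟩
  · by_contra! hlt
    have h1 := h.twist_inv x (f (a', t)).2 y (h.maps htA).1 hlt.le hyA.2
    rw [← hf, h.left_inv _ htA] at h1
    have := mul_pos h.c_pos (sub_pos.2 hlt)
    dsimp only at h1
    linarith
  · exact ⟨(a', t), hlow _ _ _ hg ht.1 ht.2, hf⟩

/-- The upper boundary of the shadow is contained in the image of the upper boundary. -/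
lemma topSet_shadow_subset (h : IsTwistPair f g c C) {L : Set (ℝ × ℝ)} (hL : L ⊆ Ann)
    {K : ℝ} (hK0 : 0 ≤ K) (hK : DownLeftClosed K L) : topSet (shadow f L) ⊆ f '' topSet L := by
  rintro ⟨x, y⟩ ⟨⟨h0, y', hy', hm⟩, htop⟩
  dsimp only at h0 hy' hm htop
  have hyy : y' = y := le_antisymm (htop y' (h.image_subset_shadow hL hm)) hy'
  subst hyy
  obtain ⟨hA, hg⟩ := (h.mem_image hL).1 hm
  refine ⟨g (x, y'), ⟨hg, fun b' hb' => ?_⟩, h.right_inv _ hA⟩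
  by_contra! hlt
  have hy1 : y' < 1 := by
    refine lt_of_le_of_ne hA.2 fun hy => ?_
    rw [hy, h.top_inv] at hlt
    exact absurd (hL hb').2 (not_le.2 hlt)
  set a := (g (x, y')).1 with ha
  set b := (g (x, y')).2 with hb
  have hC1 : 0 < C * (1 + K) + 1 := by
    have := mul_nonneg h.C_nonneg (add_nonneg zero_le_one hK0)
    linarith
  set t := min (1 - y') ((b' - b) / (C * (1 + K) + 1)) with ht
  have ht0 : 0 < t := lt_min (by linarith) (div_pos (by linarith) hC1)
  have ht1 : t ≤ 1 - y' := min_le_left _ _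
  have ht2 : t * (C * (1 + K) + 1) ≤ b' - b := by
    rw [← le_div_iff₀ hC1]; exact min_le_right _ _
  have htA : (x, y' + t) ∈ Ann := ⟨by linarith, by linarith⟩
  have hd := h.lip_inv _ htA _ hA
  have hd0 : dist (x, y' + t) (x, y') = t := by
    simp [Prod.dist_eq, abs_of_pos ht0, ht0.le]
  rw [hd0, Prod.dist_eq, max_le_iff, Real.dist_eq, Real.dist_eq, abs_le, abs_le] at hd
  have htw := h.twist_inv x y' (y' + t) h0 (by linarith) (by linarith)
  have hc : 0 ≤ c * (y' + t - y') := mul_nonneg h.c_pos.le (by linarith)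
  have hmem : g (x, y' + t) ∈ L := by
    refine hK _ a _ b' hb' (by linarith) (h.maps_inv htA).1 ?_
    have : K * (a - (g (x, y' + t)).1) ≤ K * (C * t) :=
      mul_le_mul_of_nonneg_left (by linarith [hd.1.1]) hK0
    nlinarith [hd.2.2]
  have := htop (y' + t) (h.image_subset_shadow hL ((h.mem_image hL).2 ⟨htA, hmem⟩))
  linarith

lemma shadow_eq_of_image_eq (h : IsTwistPair f g c C) {L : Set (ℝ × ℝ)} (hL : L ⊆ Ann)
    (hlow : IsLowerRegion L) (hf : f '' L = L) : shadow f L = L := by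
  apply Subset.antisymm
  · rintro ⟨x, y⟩ ⟨h0, y', hy, hm⟩
    rw [hf] at hm
    exact hlow _ _ _ hm h0 hy
  · intro p hp
    rw [← hf] at hp
    exact h.image_subset_shadow hL hp

/-- An invariant closed lower region that cannot rise steeply to the right is bounded by an
invariant Lipschitz graph. -/
lemma exists_graph_of_invariant (h : IsTwistPair f g c C) {L : Set (ℝ × ℝ)} (hL : L ⊆ Ann)
    (hc : IsClosed L) {K : ℝ} (hK0 : 0 ≤ K) (hK : DownLeftClosed K L)
    (hbot : ∀ x, (x, (0 : ℝ)) ∈ L) (hf : f '' L = L) :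
    ∃ ψ : ℝ → ℝ, (∃ K, LipschitzWith K ψ) ∧ (∀ x y, (x, y) ∈ L ↔ 0 ≤ y ∧ y ≤ ψ x) ∧
      f '' torusGraph ψ = torusGraph ψ := by
  have hg : g '' L = L := by
    nth_rw 1 [← hf]
    rw [image_image]
    simpa using image_congr fun p hp => h.left_inv p (hL hp)
  have hlow := hK.isLowerRegion
  set L' : Set (ℝ × ℝ) := reflect ⁻¹' L with hL'
  have hL'A : L' ⊆ Ann := fun p hp => reflect_mem_Ann.1 (hL hp)
  have hlow' : IsLowerRegion L' := fun x y y' hm h0 hy => hlow (-x) y y' hm h0 hy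
  have hf' : (fun p => reflect (g (reflect p))) '' L' = L' := by
    ext p
    constructor
    · rintro ⟨q, hq, rfl⟩
      rw [hL', mem_preimage, reflect_reflect, ← hg]
      exact mem_image_of_mem g hq
    · intro hp
      rw [hL', mem_preimage, ← hg] at hp
      obtain ⟨q, hq, e⟩ := hp
      exact ⟨reflect q, by rwa [hL', mem_preimage, reflect_reflect], by
        simp only [reflect_reflect, e]⟩
  have hsh := h.shadow_eq_of_image_eq hL hlow hf
  have hsh' := h.mirrored.shadow_eq_of_image_eq hL'A hlow' hf'
  have hD' := h.mirrored.downLeftClosed_shadow hL'A hlow'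
  have htop := h.topSet_shadow_subset hL hK0 hK
  have htop' := h.mirrored.topSet_shadow_subset hL'A (div_nonneg h.C_nonneg h.c_pos.le)
    (hsh' ▸ hD')
  rw [hsh'] at hD' htop'
  rw [hsh] at htop
  have hgr : ∀ x, IsGreatest {y | (x, y) ∈ L} (sSup {y | (x, y) ∈ L}) := fun x =>
    (isCompact_Icc.of_isClosed_subset (hc.preimage (by fun_prop : Continuous fun y => (x, y)))
      fun y hy => hL hy).isGreatest_sSup ⟨0, hbot x⟩
  set ψ : ℝ → ℝ := fun x => sSup {y | (x, y) ∈ L} with hψ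
  have hmem : ∀ x, (x, ψ x) ∈ L := fun x => (hgr x).1
  have hle : ∀ x y, (x, y) ∈ L → y ≤ ψ x := fun x y hy => (hgr x).2 hy
  have hψ0 : ∀ x, 0 ≤ ψ x := fun x => (hL (hmem x)).1
  have hgraph : torusGraph ψ = topSet L := by
    ext ⟨x, y⟩
    constructor
    · intro (e : y = ψ x)
      subst e
      exact ⟨hmem x, hle x⟩
    · rintro ⟨h1, h2⟩
      exact le_antisymm (hle x y h1) (h2 _ (hmem x))
  refine ⟨ψ, ⟨⟨max K (C / c), le_max_of_le_left hK0⟩, ?_⟩, fun x y =>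
    ⟨fun hy => ⟨(hL hy).1, hle x y hy⟩, fun hy => hlow _ _ _ (hmem x) hy.1 hy.2⟩, ?_⟩
  · have hup : ∀ x x', x ≤ x' → ψ x' - K * (x' - x) ≤ ψ x := fun x x' hx => by
      rcases le_total 0 (ψ x' - K * (x' - x)) with h0 | h0
      · exact hle _ _ (hK x x' _ _ (hmem x') hx h0 (by linarith))
      · exact h0.trans (hψ0 x)
    have hdown : ∀ x x', x' ≤ x → ψ x' - C / c * (x - x') ≤ ψ x := fun x x' hx => by
      rcases le_total 0 (ψ x' - C / c * (x - x')) with h0 | h0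
      · refine hle _ _ ?_
        have hm : (-x', ψ x') ∈ L' := by simpa [hL', reflect] using hmem x'
        simpa [hL', reflect] using
          hD' (-x) (-x') _ _ hm (by linarith) h0 (by linarith)
      · exact h0.trans (hψ0 x)
    refine LipschitzWith.of_le_add_mul _ fun x' x => ?_
    rw [Real.dist_eq]
    change ψ x' ≤ ψ x + max K (C / c) * |x' - x|
    rcases le_total x x' with hx | hx
    · have := mul_le_mul_of_nonneg_right (le_max_left K (C / c)) (sub_nonneg.2 hx)
      rw [abs_of_nonneg (sub_nonneg.2 hx)]
      linarith [hup x x' hx]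
    · have := mul_le_mul_of_nonneg_right (le_max_right K (C / c)) (sub_nonneg.2 hx)
      rw [abs_sub_comm, abs_of_nonneg (sub_nonneg.2 hx)]
      linarith [hdown x x' hx]
  · rw [hgraph]
    refine Subset.antisymm ?_ htop
    rintro _ ⟨p, hp, rfl⟩
    have hp' : reflect p ∈ topSet L' := by
      refine ⟨by simpa [hL', reflect_reflect] using hp.1, fun y hy => hp.2 y ?_⟩
      simpa [hL', reflect] using hy
    obtain ⟨q, hq, e⟩ := htop' hp'
    dsimp only at e
    have hq' : reflect q ∈ topSet L := by
      refine ⟨hq.1, fun y hy => hq.2 y ?_⟩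
      simpa [hL', reflect] using hy
    have e' : g (reflect q) = p := by
      rw [← reflect_reflect (g _), e, reflect_reflect]
    rwa [← e', h.right_inv _ (hL hq'.1)]

end IsTwistPair

lemma add_int_mem_Ann {p : ℝ × ℝ} (hp : p ∈ Ann) (j : ℤ) : p + ((j : ℝ), 0) ∈ Ann := by
  simpa [Ann] using hp

lemma convex_Ann : Convex ℝ Ann :=
  (convex_Icc (0 : ℝ) 1).linear_preimage (LinearMap.snd ℝ ℝ ℝ)

lemma uniqueDiffOn_Ann : UniqueDiffOn ℝ Ann := by
  have : Ann = univ ×ˢ Icc (0 : ℝ) 1 := by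
    ext p
    simp [Ann]
  rw [this]
  exact uniqueDiffOn_univ.prod (uniqueDiffOn_Icc zero_lt_one)

/-- A map of the annulus commuting with the unit translation. -/
def CommutesWithShift (h : ℝ × ℝ → ℝ × ℝ) : Prop :=
  ∀ p ∈ Ann, ∀ j : ℤ, h (p + ((j : ℝ), 0)) = h p + ((j : ℝ), 0)

lemma commutesWithShift_of_add_one {h : ℝ × ℝ → ℝ × ℝ}
    (h1 : ∀ p ∈ Ann, h (p.1 + 1, p.2) = h p + (1, 0)) : CommutesWithShift h := by
  intro p hp j
  induction j with
  | zero => simp [← Prod.zero_eq_mk]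
  | succ i ih =>
    have := h1 _ (add_int_mem_Ann hp i)
    rw [ih] at this
    convert this using 1
    · congr 1
      ext <;> simp [add_assoc]
    · ext <;> simp [add_assoc]
  | pred i ih =>
    have := h1 _ (add_int_mem_Ann hp (-i - 1))
    rw [← sub_eq_iff_eq_add] at this
    rw [← this]
    have e : ((p + (((-i - 1 : ℤ) : ℝ), (0 : ℝ))).1 + 1, (p + (((-i - 1 : ℤ) : ℝ), (0 : ℝ))).2)
        = p + (((-i : ℤ) : ℝ), (0 : ℝ)) := by
      ext <;> simp [add_assoc]
    rw [e, ih]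
    ext <;> simp [add_assoc, sub_eq_add_neg]

namespace CommutesWithShift

variable {h : ℝ × ℝ → ℝ × ℝ}

open scoped Pointwise in
lemma fderivWithin_add_int (hs : CommutesWithShift h) {p : ℝ × ℝ} (hp : p ∈ Ann) (j : ℤ) :
    fderivWithin ℝ h Ann (p + ((j : ℝ), 0)) = fderivWithin ℝ h Ann p := by
  have hA : (((j : ℝ), (0 : ℝ)) +ᵥ Ann : Set (ℝ × ℝ)) = Ann := by
    ext q
    rw [mem_vadd_set_iff_neg_vadd_mem]
    simp [Ann]
  rw [← hA, ← fderivWithin_comp_add_right, hA,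
    fderivWithin_congr (f := fun p => h p + ((j : ℝ), 0)) (fun q hq => hs q hq j) (hs p hp j),
    fderivWithin_add_const]

/-- A periodic property that holds on a fundamental domain holds on the whole annulus. -/
lemma _root_.forall_mem_Ann_of_periodic {P : ℝ × ℝ → Prop}
    (hper : ∀ p ∈ Ann, ∀ j : ℤ, P p → P (p + ((j : ℝ), 0)))
    (hP : ∀ p ∈ Icc (0 : ℝ) 1 ×ˢ Icc (0 : ℝ) 1, P p) : ∀ p ∈ Ann, P p := by
  intro p hp
  have hq : (Int.fract p.1, p.2) ∈ Icc (0 : ℝ) 1 ×ˢ Icc (0 : ℝ) 1 :=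
    ⟨⟨Int.fract_nonneg _, (Int.fract_lt_one _).le⟩, hp⟩
  have := hper _ hq.2 ⌊p.1⌋ (hP _ hq)
  convert this using 1
  ext <;> simp

lemma exists_lipschitz (hs : CommutesWithShift h) (hd : ContDiffOn ℝ 1 h Ann) :
    ∃ C, 0 ≤ C ∧ ∀ p ∈ Ann, ∀ q ∈ Ann, dist (h p) (h q) ≤ C * dist p q := by
  have hcont := hd.continuousOn_fderivWithin uniqueDiffOn_Ann le_rfl
  have hsub : Icc (0 : ℝ) 1 ×ˢ Icc (0 : ℝ) 1 ⊆ Ann := fun p hp => hp.2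
  obtain ⟨C, hC⟩ := (isCompact_Icc.prod isCompact_Icc).exists_bound_of_continuousOn
    (hcont.mono hsub)
  have hC' : ∀ p ∈ Ann, ‖fderivWithin ℝ h Ann p‖ ≤ C :=
    forall_mem_Ann_of_periodic (fun p hp j hle => by rwa [hs.fderivWithin_add_int hp]) hC
  refine ⟨C, (norm_nonneg _).trans (hC' (0, 0) ⟨le_rfl, zero_le_one⟩), fun p hp q hq => ?_⟩
  rw [dist_eq_norm, dist_eq_norm]
  exact convex_Ann.norm_image_sub_le_of_norm_hasFDerivWithin_le
    (fun x hx => ((hd.differentiableOn one_ne_zero) x hx).hasFDerivWithinAt) hC' hq hp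

lemma hasDerivWithinAt_vertical (hd : ContDiffOn ℝ 1 h Ann) {x y : ℝ} (hy : y ∈ Icc (0 : ℝ) 1) :
    HasDerivWithinAt (fun y => (h (x, y)).1) (fderivWithin ℝ h Ann (x, y) (0, 1)).1
      (Icc (0 : ℝ) 1) y := by
  have h1 : HasFDerivWithinAt h (fderivWithin ℝ h Ann (x, y)) Ann (x, y) :=
    ((hd.differentiableOn one_ne_zero) (x, y) hy).hasFDerivWithinAt
  have h2 : HasDerivWithinAt (fun y : ℝ => (x, y)) ((0 : ℝ), (1 : ℝ)) (Icc (0 : ℝ) 1) y :=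
    (hasDerivWithinAt_const y _ x).prodMk (hasDerivWithinAt_id y _)
  have h3 := h1.comp_hasDerivWithinAt y h2 (fun t ht => ht)
  exact (ContinuousLinearMap.fst ℝ ℝ ℝ).hasFDerivAt.comp_hasDerivWithinAt y h3

lemma exists_twist (hs : CommutesWithShift h) (hd : ContDiffOn ℝ 1 h Ann) {s : ℝ}
    (hpos : ∀ p ∈ Ann, 0 < s * (fderivWithin ℝ h Ann p (0, 1)).1) :
    ∃ c > 0, ∀ x y y', 0 ≤ y → y ≤ y' → y' ≤ 1 →
      c * (y' - y) ≤ s * (h (x, y')).1 - s * (h (x, y)).1 := by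
  have hcont := hd.continuousOn_fderivWithin uniqueDiffOn_Ann le_rfl
  have hsub : Icc (0 : ℝ) 1 ×ˢ Icc (0 : ℝ) 1 ⊆ Ann := fun p hp => hp.2
  have hcont' : ContinuousOn (fun p => s * (fderivWithin ℝ h Ann p (0, 1)).1) Ann :=
    continuousOn_const.mul (continuous_fst.comp_continuousOn (hcont.clm_apply continuousOn_const))
  obtain ⟨p₀, hp₀, hmin⟩ := (isCompact_Icc.prod isCompact_Icc).exists_isMinOn
    ⟨((0 : ℝ), (0 : ℝ)), by simp⟩ (hcont'.mono hsub)
  have hmin' : ∀ p ∈ Ann, s * (fderivWithin ℝ h Ann p₀ (0, 1)).1 ≤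
      s * (fderivWithin ℝ h Ann p (0, 1)).1 :=
    forall_mem_Ann_of_periodic (fun p hp j hle => by rwa [hs.fderivWithin_add_int hp])
      fun p hp => hmin hp
  refine ⟨_, hpos p₀ (hsub hp₀), fun x y y' h0 hy h1 => ?_⟩
  have hder : ∀ y ∈ Icc (0 : ℝ) 1, HasDerivWithinAt (fun y => s * (h (x, y)).1)
      (s * (fderivWithin ℝ h Ann (x, y) (0, 1)).1) (Icc (0 : ℝ) 1) y :=
    fun y hy => (hasDerivWithinAt_vertical hd hy).const_mul s
  refine (convex_Icc (0 : ℝ) 1).mul_sub_le_image_sub_of_le_deriv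
    (fun y hy => (hder y hy).continuousWithinAt)
    (fun y hy => ((hder y (interior_subset hy)).differentiableWithinAt).mono interior_subset)
    (fun y hy => ?_) y ⟨h0, hy.trans h1⟩ y' ⟨h0.trans hy, h1⟩ hy
  rw [((hder y (interior_subset hy)).hasDerivAt (mem_interior_iff_mem_nhds.1 hy)).deriv]
  have hyI : y ∈ Icc (0 : ℝ) 1 := interior_subset hy
  exact hmin' (x, y) hyI

/-- The lift of the circle map induced on an invariant graph. -/
def boundaryLift (hs : CommutesWithShift h) (hc : ContinuousOn h Ann) (hi : InjOn h Ann)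
    (φ : ℝ → ℝ) (hφc : Continuous φ) (hφ : ∀ x, φ x ∈ Icc (0 : ℝ) 1)
    (hφ1 : ∀ x, φ (x + 1) = φ x) (hinv : ∀ x, (h (x, φ x)).2 = φ (h (x, φ x)).1) :
    CircleDeg1Lift :=
  .ofInjective (fun x => (h (x, φ x)).1)
    (continuous_fst.comp (hc.comp_continuous (by fun_prop) fun x => hφ x))
    (fun x x' e => by
      dsimp only at e
      have h2 : (h (x, φ x)).2 = (h (x', φ x')).2 := by rw [hinv, hinv, e]
      exact congrArg Prod.fst (hi (hφ x) (hφ x') (Prod.ext e h2)))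
    (fun x => by
      have := hs (x, φ x) (hφ x) 1
      simp only [Prod.mk_add_mk, Int.cast_one, add_zero] at this
      rw [hφ1, this]
      simp)

end CommutesWithShift

lemma LinearMap.det_prod_eq (A : ℝ × ℝ →ₗ[ℝ] ℝ × ℝ) :
    LinearMap.det A = (A (1, 0)).1 * (A (0, 1)).2 - (A (0, 1)).1 * (A (1, 0)).2 := by
  rw [← LinearMap.det_toMatrix (Module.Basis.finTwoProd ℝ), Matrix.det_fin_two]
  simp [LinearMap.toMatrix_apply]

/-- If a linear map of positive determinant tilts the vertical to the right, then its inverse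
tilts it to the left. -/
lemma fst_neg_of_comp_eq_id {A B : ℝ × ℝ →L[ℝ] ℝ × ℝ} (hdet : 0 < LinearMap.det A.toLinearMap)
    (hA : 0 < (A (0, 1)).1) (hAB : A.comp B = ContinuousLinearMap.id ℝ (ℝ × ℝ)) :
    (B (0, 1)).1 < 0 := by
  have hB : A (B (0, 1)) = (0, 1) := by
    rw [← ContinuousLinearMap.comp_apply, hAB]
    rfl
  set u := (B (0, 1)).1
  set v := (B (0, 1)).2
  have e : B (0, 1) = u • ((1 : ℝ), (0 : ℝ)) + v • ((0 : ℝ), (1 : ℝ)) := by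
    ext <;> simp [u, v]
  rw [e, map_add, map_smul, map_smul] at hB
  have e1 := congrArg Prod.fst hB
  have e2 := congrArg Prod.snd hB
  rw [LinearMap.det_prod_eq] at hdet
  simp only [ContinuousLinearMap.coe_coe, Prod.fst_add, Prod.snd_add, Prod.smul_fst,
    Prod.smul_snd, smul_eq_mul] at hdet e1 e2
  by_contra! hu
  have h1 := mul_nonneg hu hdet.le
  have h2 : u * ((A (1, 0)).1 * (A (0, 1)).2 - (A (0, 1)).1 * (A (1, 0)).2) = -(A (0, 1)).1 := by
    linear_combination (A (0, 1)).2 * e1 - (A (0, 1)).1 * e2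
  linarith

namespace AnnulusTwistMap

variable (F : AnnulusTwistMap)

lemma commutesWithShift : CommutesWithShift F.f := commutesWithShift_of_add_one F.lift

lemma commutesWithShift_inv : CommutesWithShift F.finv := by
  intro p hp j
  have hg := F.maps_inv hp
  rw [← F.left_inv _ (add_int_mem_Ann hg j), F.commutesWithShift _ hg, F.right_inv p hp]

lemma injOn : InjOn F.f Ann := fun p hp q hq e => by
  rw [← F.left_inv p hp, e, F.left_inv q hq]

lemma injOn_inv : InjOn F.finv Ann := fun p hp q hq e => by
  rw [← F.right_inv p hp, e, F.right_inv q hq]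

lemma fderivWithin_comp_inv {p : ℝ × ℝ} (hp : p ∈ Ann) :
    (fderivWithin ℝ F.f Ann (F.finv p)).comp (fderivWithin ℝ F.finv Ann p) =
      ContinuousLinearMap.id ℝ (ℝ × ℝ) := by
  have hu := uniqueDiffOn_Ann p hp
  rw [← fderivWithin_comp p ((F.smooth.differentiableOn one_ne_zero) _ (F.maps_inv hp))
    ((F.smooth_inv.differentiableOn one_ne_zero) p hp) F.maps_inv hu,
    fderivWithin_congr (f := id) (f₁ := F.f ∘ F.finv) (fun q hq => F.right_inv q hq)
      (F.right_inv p hp),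
    fderivWithin_id hu]

lemma fderivWithin_pos {p : ℝ × ℝ} (hp : p ∈ Ann) : 0 < (fderivWithin ℝ F.f Ann p (0, 1)).1 := by
  have := F.twist p hp
  rwa [(CommutesWithShift.hasDerivWithinAt_vertical F.smooth (x := p.1) hp).derivWithin
    (uniqueDiffOn_Icc zero_lt_one _ hp)] at this

/-- The inverse preserves every horizontal line that is preserved by the map. -/
lemma inv_mem_level (y : ℝ) (hy : y ∈ Icc (0 : ℝ) 1) (hf : ∀ x, (F.f (x, y)).2 = y) (x : ℝ) :
    (F.finv (x, y)).2 = y := by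
  let G := F.commutesWithShift.boundaryLift F.smooth.continuousOn F.injOn (fun _ => y)
    continuous_const (fun _ => hy) (fun _ => rfl) hf
  have hG : Continuous G := continuous_fst.comp
    (F.smooth.continuousOn.comp_continuous (by fun_prop) fun _ => hy)
  obtain ⟨a, ha⟩ := G.continuous_iff_surjective.1 hG x
  have : F.f (a, y) = (x, y) := Prod.ext ha (hf a)
  rw [← this, F.left_inv _ hy]

lemma isTwistPair : ∃ c C, IsTwistPair F.f F.finv c C := by
  obtain ⟨C₁, h₁, hC₁⟩ := F.commutesWithShift.exists_lipschitz F.smooth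
  obtain ⟨C₂, h₂, hC₂⟩ := F.commutesWithShift_inv.exists_lipschitz F.smooth_inv
  obtain ⟨c₁, hc₁, ht₁⟩ := F.commutesWithShift.exists_twist F.smooth (s := 1)
    fun p hp => by simpa using F.fderivWithin_pos hp
  obtain ⟨c₂, hc₂, ht₂⟩ := F.commutesWithShift_inv.exists_twist F.smooth_inv (s := -1)
    fun p hp => by
      have := fst_neg_of_comp_eq_id (F.orient _ (F.maps_inv hp))
        (F.fderivWithin_pos (F.maps_inv hp)) (F.fderivWithin_comp_inv hp)
      linarith
  have h0 : (0 : ℝ) ∈ Icc (0 : ℝ) 1 := ⟨le_rfl, zero_le_one⟩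
  have h1 : (1 : ℝ) ∈ Icc (0 : ℝ) 1 := ⟨zero_le_one, le_rfl⟩
  have hb := F.inv_mem_level 0 h0 F.bottom
  refine ⟨min c₁ c₂, max C₁ C₂, lt_min hc₁ hc₂, le_max_of_le_left h₁, F.maps, F.maps_inv,
    F.left_inv, F.right_inv, fun p hp q hq => ?_, fun p hp q hq => ?_, fun x y y' hy hyy hy1 => ?_,
    fun x y y' hy hyy hy1 => ?_, F.bottom, hb, F.top, F.inv_mem_level 1 h1 F.top, ?_, ?_⟩
  · exact (hC₁ p hp q hq).trans (by gcongr; exact le_max_left _ _)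
  · exact (hC₂ p hp q hq).trans (by gcongr; exact le_max_right _ _)
  · have := mul_le_mul_of_nonneg_right (min_le_left c₁ c₂) (sub_nonneg.2 hyy)
    linarith [ht₁ x y y' hy hyy hy1]
  · have := mul_le_mul_of_nonneg_right (min_le_right c₁ c₂) (sub_nonneg.2 hyy)
    linarith [ht₂ x y y' hy hyy hy1]
  · exact (F.commutesWithShift.boundaryLift F.smooth.continuousOn F.injOn (fun _ => 0)
      continuous_const (fun _ => h0) (fun _ => rfl) F.bottom).monotone
  · exact (F.commutesWithShift_inv.boundaryLift F.smooth_inv.continuousOn F.injOn_inv (fun _ => 0)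
      continuous_const (fun _ => h0) (fun _ => rfl) hb).monotone

end AnnulusTwistMap

/-- A set that is invariant under the integer translations of the first coordinate. -/
def ShiftInvariant (M : Set (ℝ × ℝ)) : Prop := ∀ p ∈ M, ∀ j : ℤ, p + ((j : ℝ), 0) ∈ M

lemma ShiftInvariant.add_mem_iff {M : Set (ℝ × ℝ)} (hM : ShiftInvariant M) {p : ℝ × ℝ} {j : ℤ} :
    p + ((j : ℝ), 0) ∈ M ↔ p ∈ M := by
  refine ⟨fun hp => ?_, fun hp => hM p hp j⟩
  convert hM _ hp (-j)
  ext <;> simp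

lemma volume_add_int_mem (S : Set (ℝ × ℝ)) (j : ℤ) :
    MeasureTheory.volume {p : ℝ × ℝ | p + ((j : ℝ), (0 : ℝ)) ∈ S} = MeasureTheory.volume S :=
  MeasureTheory.measure_preimage_add_right MeasureTheory.volume ((j : ℝ), (0 : ℝ)) S

lemma volume_eq_tsum_fibers {S : Set (ℝ × ℝ)} {k : ℝ × ℝ → ℤ}
    (hk : ∀ j, MeasurableSet (S ∩ k ⁻¹' {j})) :
    MeasureTheory.volume S = ∑' j, MeasureTheory.volume (S ∩ k ⁻¹' {j}) := by
  rw [← MeasureTheory.measure_iUnion _ hk]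
  · congr 1
    ext p
    simp
  · intro i j hij
    refine Set.disjoint_left.2 fun p hp hq => hij ?_
    rw [← show k p = i from hp.2, show k p = j from hq.2]

lemma measurableSet_Ann_inter_preimage {h : ℝ × ℝ → ℝ × ℝ} (hc : ContinuousOn h Ann)
    {B : Set (ℝ × ℝ)} (hB : MeasurableSet B) : MeasurableSet (Ann ∩ h ⁻¹' B) := by
  classical
  have hm : Measurable (Ann.piecewise h fun _ => 0) :=
    hc.measurable_piecewise continuousOn_const isClosed_Ann.measurableSet
  convert isClosed_Ann.measurableSet.inter (hm hB) using 1
  ext p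
  refine and_congr_right fun hp => ?_
  simp [hp]

lemma measurable_floor_fst : Measurable fun p : ℝ × ℝ => ⌊p.1⌋ :=
  Int.measurable_floor.comp measurable_fst

namespace AnnulusTwistMap

variable (F : AnnulusTwistMap)

lemma mem_image {L : Set (ℝ × ℝ)} (hL : L ⊆ Ann) {p : ℝ × ℝ} :
    p ∈ F.f '' L ↔ p ∈ Ann ∧ F.finv p ∈ L := by
  obtain ⟨c, C, h⟩ := F.isTwistPair
  exact h.mem_image hL

lemma measurableSet_image {L : Set (ℝ × ℝ)} (hL : L ⊆ Ann) (hm : MeasurableSet L) :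
    MeasurableSet (F.f '' L) := by
  convert measurableSet_Ann_inter_preimage F.smooth_inv.continuousOn hm using 1
  ext p
  exact F.mem_image hL

lemma shiftInvariant_image {L : Set (ℝ × ℝ)} (hL : L ⊆ Ann) (hs : ShiftInvariant L) :
    ShiftInvariant (F.f '' L) := by
  rintro _ ⟨p, hp, rfl⟩ j
  exact ⟨_, hs p hp j, F.commutesWithShift p (hL hp) j⟩

/-- The image of a translation invariant set has the same area as that set in a fundamental
domain of the translations. -/
lemma volume_image_inter_floor {M : Set (ℝ × ℝ)} (hM : M ⊆ Ann) (hm : MeasurableSet M)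
    (hs : ShiftInvariant M) :
    MeasureTheory.volume (F.f '' M ∩ {p | ⌊p.1⌋ = 0}) =
      MeasureTheory.volume (M ∩ {p | ⌊p.1⌋ = 0}) := by
  have hD : ∀ j : ℤ, MeasurableSet {p : ℝ × ℝ | ⌊p.1⌋ = j} := fun j =>
    measurable_floor_fst (measurableSet_singleton j)
  have hMD : M ∩ {p | ⌊p.1⌋ = 0} ⊆ Ann := inter_subset_left.trans hM
  have hN := F.measurableSet_image hM hm
  have hND := F.measurableSet_image hMD (hm.inter (hD 0))
  have hNs := F.shiftInvariant_image hM hs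
  rw [← F.area _ hMD (hm.inter (hD 0)),
    volume_eq_tsum_fibers (S := F.f '' M ∩ {p | ⌊p.1⌋ = 0}) (k := fun p => ⌊(F.finv p).1⌋),
    volume_eq_tsum_fibers (k := fun p => ⌊p.1⌋) fun j => hND.inter (hD j),
    ← (Equiv.neg ℤ).tsum_eq]
  · refine tsum_congr fun j => ?_
    rw [← volume_add_int_mem _ (-j)]
    congr 1
    ext p
    simp only [mem_ofPred_eq, mem_inter_iff, mem_preimage, mem_singleton_iff, hNs.add_mem_iff,
      F.mem_image hM, F.mem_image hMD, Equiv.neg_apply, Prod.fst_add, Int.floor_add_intCast]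
    constructor
    · rintro ⟨⟨⟨hp, hg⟩, h0⟩, h1⟩
      rw [F.commutesWithShift_inv p hp, Prod.fst_add, Int.floor_add_intCast] at h1
      exact ⟨⟨hp, hg, by omega⟩, by omega⟩
    · rintro ⟨⟨hp, hg, h1⟩, h0⟩
      rw [F.commutesWithShift_inv p hp, Prod.fst_add, Int.floor_add_intCast]
      exact ⟨⟨⟨hp, hg⟩, by omega⟩, by omega⟩
  · intro j
    convert (hN.inter (hD 0)).inter
      (measurableSet_Ann_inter_preimage F.smooth_inv.continuousOn (hD j)) using 1
    ext p
    simp only [mem_inter_iff, F.mem_image hM, mem_preimage, mem_singleton_iff, mem_ofPred_eq]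
    tauto

/-- A forward invariant, translation invariant region is invariant up to a null set. -/
lemma volume_diff_image_eq_zero {M : Set (ℝ × ℝ)} (hM : M ⊆ Ann) (hm : MeasurableSet M)
    (hs : ShiftInvariant M) (hf : F.f '' M ⊆ M) : MeasureTheory.volume (M \ F.f '' M) = 0 := by
  have hD : MeasurableSet {p : ℝ × ℝ | ⌊p.1⌋ = 0} :=
    measurable_floor_fst (measurableSet_singleton 0)
  have hN := F.measurableSet_image hM hm
  have hNs := F.shiftInvariant_image hM hs
  have hfin : MeasureTheory.volume (M ∩ {p | ⌊p.1⌋ = 0}) ≠ ⊤ := by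
    have hK : IsCompact (Icc (0 : ℝ) 1 ×ˢ Icc (0 : ℝ) 1) := isCompact_Icc.prod isCompact_Icc
    refine MeasureTheory.measure_ne_top_of_subset ?_ (hK.measure_ne_top (μ := MeasureTheory.volume))
    rintro p ⟨hp, h0⟩
    rw [mem_ofPred_eq, Int.floor_eq_zero_iff] at h0
    exact ⟨⟨h0.1, h0.2.le⟩, hM hp⟩
  have hzero : MeasureTheory.volume ((M \ F.f '' M) ∩ {p | ⌊p.1⌋ = 0}) = 0 := by
    rw [inter_comm, inter_sdiff_distrib_left, inter_comm _ M, inter_comm _ (F.f '' M),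
      MeasureTheory.measure_sdiff (inter_subset_inter_left _ hf)
        (hN.inter hD).nullMeasurableSet (by rwa [F.volume_image_inter_floor hM hm hs]),
      F.volume_image_inter_floor hM hm hs, tsub_self]
  rw [volume_eq_tsum_fibers (k := fun p => ⌊p.1⌋) fun j =>
    (hm.diff hN).inter (measurable_floor_fst (measurableSet_singleton j))]
  refine ENNReal.tsum_eq_zero.2 fun j => ?_
  rw [← volume_add_int_mem _ j, ← hzero]
  congr 1
  ext p
  simp [hs.add_mem_iff, hNs.add_mem_iff]

end AnnulusTwistMap

lemma CommutesWithShift.iterate {h : ℝ × ℝ → ℝ × ℝ} (hs : CommutesWithShift h)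
    (hm : MapsTo h Ann Ann) (n : ℕ) : CommutesWithShift h^[n] := by
  intro p hp j
  induction n with
  | zero => rfl
  | succ n ih =>
    rw [Function.iterate_succ_apply', Function.iterate_succ_apply', ih, hs _ (hm.iterate n hp)]

lemma AnnulusTwistMap.iterate_left_inv (F : AnnulusTwistMap) (n : ℕ) {p : ℝ × ℝ} (hp : p ∈ Ann) :
    F.finv^[n] (F.f^[n] p) = p := by
  induction n with
  | zero => rfl
  | succ n ih =>
    rw [Function.iterate_succ_apply, Function.iterate_succ_apply',
      F.left_inv _ (F.maps.iterate n hp), ih]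

lemma AnnulusTwistMap.iterate_right_inv (F : AnnulusTwistMap) (n : ℕ) {p : ℝ × ℝ} (hp : p ∈ Ann) :
    F.f^[n] (F.finv^[n] p) = p := by
  induction n with
  | zero => rfl
  | succ n ih =>
    rw [Function.iterate_succ_apply, Function.iterate_succ_apply',
      F.right_inv _ (F.maps_inv.iterate n hp), ih]

namespace IsPrimaryTorusFn

variable {F : AnnulusTwistMap} {φ : ℝ → ℝ}

lemma continuous (hφ : IsPrimaryTorusFn F φ) : Continuous φ := by
  obtain ⟨⟨K, hK⟩, -⟩ := hφ
  exact hK.continuous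

lemma graph_mem_Ann (hφ : IsPrimaryTorusFn F φ) (x : ℝ) : (x, φ x) ∈ Ann := hφ.2.1 x

lemma apply_add_int (hφ : IsPrimaryTorusFn F φ) (x : ℝ) (j : ℤ) : φ (x + j) = φ x := by
  have h1 : Function.Periodic φ 1 := hφ.2.2.1
  simpa using h1.int_mul j x

lemma snd_map (hφ : IsPrimaryTorusFn F φ) (x : ℝ) :
    (F.f (x, φ x)).2 = φ (F.f (x, φ x)).1 := by
  have h1 : F.f (x, φ x) ∈ torusGraph φ := by
    rw [← hφ.2.2.2]
    exact mem_image_of_mem _ (show φ x = φ x from rfl)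
  exact h1

lemma mem_of_map_mem (hφ : IsPrimaryTorusFn F φ) {p : ℝ × ℝ} (hp : p ∈ Ann)
    (hf : F.f p ∈ torusGraph φ) : p ∈ torusGraph φ := by
  rw [← hφ.2.2.2] at hf
  obtain ⟨q, hq, e⟩ := hf
  have hqA : q ∈ Ann := by
    have h1 := hφ.2.1 q.1
    rwa [← show q.2 = φ q.1 from hq] at h1
  rwa [← F.injOn hqA hp e]

lemma mem_of_iterate_mem (hφ : IsPrimaryTorusFn F φ) (n : ℕ) {p : ℝ × ℝ} (hp : p ∈ Ann)
    (hf : F.f^[n] p ∈ torusGraph φ) : p ∈ torusGraph φ := by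
  induction n generalizing p with
  | zero => exact hf
  | succ n ih => exact hφ.mem_of_map_mem hp (ih (F.maps hp) hf)

/-- On a transitive torus, every arc has a forward image containing a given point, up to integer
translation. -/
lemma exists_iterate_eq (hφ : IsPrimaryTorusFn F φ) (ht : TransitiveOnTorus F φ) (x : ℝ)
    {a b : ℝ} (hab : a < b) :
    ∃ n : ℕ, 0 < n ∧ ∃ j : ℤ, ∃ u ∈ Ioo a b, F.f^[n] (u, φ u) = (x, φ x) + ((j : ℝ), 0) := by
  let G := F.commutesWithShift.boundaryLift F.smooth.continuousOn F.injOn φ hφ.continuous hφ.2.1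
    hφ.2.2.1 hφ.snd_map
  have hG : Continuous G := continuous_fst.comp
    (F.smooth.continuousOn.comp_continuous (continuous_id.prodMk hφ.continuous) hφ.graph_mem_Ann)
  have hit : ∀ n u, F.f^[n] (u, φ u) = (G^[n] u, φ (G^[n] u)) := fun n u => by
    induction n with
    | zero => rfl
    | succ n ih =>
      rw [Function.iterate_succ_apply', Function.iterate_succ_apply', ih]
      exact Prod.ext rfl (hφ.snd_map _)
  obtain ⟨⟨x₀, y₀⟩, hp, hd⟩ := ht
  obtain rfl : y₀ = φ x₀ := hp
  obtain ⟨n, hn, j, u, hu, e⟩ := G.exists_iterate_eq_of_dense hG x₀ (fun y ε hε => by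
    obtain ⟨n, j, h1⟩ := hd (y, φ y) rfl ε hε
    refine ⟨n, j, ?_⟩
    rw [hit] at h1
    exact (le_max_left _ _).trans_lt h1) x hab
  refine ⟨n, hn, j, u, hu, ?_⟩
  rw [hit, e, hφ.apply_add_int]
  simp

/-- A torus touching a transitive torus coincides with it. -/
lemma eq_of_transitive {ψ : ℝ → ℝ} (hψ : IsPrimaryTorusFn F ψ) (hφ : IsPrimaryTorusFn F φ)
    (ht : TransitiveOnTorus F φ) {x₀ : ℝ} (h0 : ψ x₀ = φ x₀) : ψ = φ := by
  ext x
  by_contra hne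
  have ho : IsOpen {x | ψ x ≠ φ x} := isOpen_ne_fun hψ.continuous hφ.continuous
  obtain ⟨ε, hε, hsub⟩ := Metric.isOpen_iff.1 ho x hne
  rw [Real.ball_eq_Ioo] at hsub
  obtain ⟨n, -, j, u, hu, e⟩ := hφ.exists_iterate_eq ht x₀ (show x - ε < x + ε by linarith)
  refine hsub hu (hψ.mem_of_iterate_mem n (hφ.graph_mem_Ann u) ?_).symm
  rw [e]
  change φ x₀ + 0 = ψ (x₀ + j)
  rw [hψ.apply_add_int, h0, add_zero]

/-- The region below an invariant torus is mapped into itself. -/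
lemma map_below (hφ : IsPrimaryTorusFn F φ) {x y : ℝ} (hy : 0 ≤ y) (hyφ : y ≤ φ x) :
    (F.f (x, y)).2 ≤ φ (F.f (x, y)).1 := by
  by_contra! hlt
  have hA : ∀ t ∈ Icc 0 y, (x, t) ∈ Ann := fun t ht =>
    ⟨ht.1, ht.2.trans (hyφ.trans (hφ.2.1 x).2)⟩
  have hc : ContinuousOn (fun t => F.f (x, t)) (Icc 0 y) :=
    F.smooth.continuousOn.comp (by fun_prop) hA
  have hc' : ContinuousOn (fun t => (F.f (x, t)).2 - φ (F.f (x, t)).1) (Icc 0 y) :=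
    (continuous_snd.comp_continuousOn hc).sub
      (hφ.continuous.comp_continuousOn (continuous_fst.comp_continuousOn hc))
  obtain ⟨t, ht, h0⟩ := intermediate_value_Icc hy hc'
    (show (0 : ℝ) ∈ Icc _ _ from
      ⟨by rw [F.bottom]; linarith [(hφ.2.1 (F.f (x, 0)).1).1], by linarith⟩)
  have h1 : t = φ x := hφ.mem_of_map_mem (hA t ht) (sub_eq_zero.1 h0)
  obtain rfl : t = y := le_antisymm ht.2 (hyφ.trans h1.ge)
  dsimp only at h0
  linarith

/-- The points of the annulus that come from a neighbourhood of a point of a transitive torus fill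
a neighbourhood of that torus. -/
lemma exists_height (hφ : IsPrimaryTorusFn F φ) (ht : TransitiveOnTorus F φ) {φ₂ : ℝ → ℝ}
    (hφ₂ : IsPrimaryTorusFn F φ₂) (hlt : ∀ x, φ x < φ₂ x) {ζ : ℝ × ℝ} (hζ : ζ ∈ torusGraph φ)
    {U₀ : Set (ℝ × ℝ)} (hU : IsOpen U₀) (hζU : ζ ∈ U₀) :
    ∃ ε > 0, (∀ x, φ x + ε < φ₂ x) ∧ ∀ x, ∃ n : ℕ, 0 < n ∧ ∃ j : ℤ, ∃ u ∈ U₀ ∩ Ann,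
      F.f^[n] u = (x, φ x + ε) + ((j : ℝ), 0) := by
  have hgc : Continuous fun x => (x, φ x) := continuous_id.prodMk hφ.continuous
  let P : Set (ℝ × ℝ) :=
    {p | p ∈ Ann → ∃ n : ℕ, 0 < n ∧ ∃ j : ℤ, ∃ u ∈ U₀ ∩ Ann, F.f^[n] u = p + ((j : ℝ), 0)}
  have hP : ∀ x, (x, φ x) ∈ interior P := by
    intro x
    rw [mem_interior_iff_mem_nhds]
    change ∀ᶠ p in 𝓝 (x, φ x), p ∈ Ann → _
    rw [← eventually_nhdsWithin_iff]
    have ho : IsOpen ((fun x => (x, φ x)) ⁻¹' U₀) := hU.preimage hgc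
    obtain ⟨δ, hδ, hsub⟩ := Metric.isOpen_iff.1 ho ζ.1
      (by rwa [mem_preimage, ← show ζ.2 = φ ζ.1 from hζ])
    rw [Real.ball_eq_Ioo] at hsub
    obtain ⟨n, hn, j, u, hu, e⟩ := hφ.exists_iterate_eq ht x
      (show ζ.1 - δ < ζ.1 + δ by linarith)
    have hadd : ContinuousOn (fun p : ℝ × ℝ => p + ((j : ℝ), (0 : ℝ))) Ann := by fun_prop
    have hc : ContinuousOn (fun p => F.finv^[n] (p + ((j : ℝ), 0))) Ann :=
      (F.smooth_inv.continuousOn.iterate F.maps_inv n).comp hadd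
        fun p hp => add_int_mem_Ann hp j
    have h1 : F.finv^[n] ((x, φ x) + ((j : ℝ), 0)) ∈ U₀ := by
      rw [← e, F.iterate_left_inv n (hφ.graph_mem_Ann u)]
      exact hsub hu
    filter_upwards [(hc _ (hφ.graph_mem_Ann x)).eventually (hU.mem_nhds h1),
      self_mem_nhdsWithin] with p hpU hpA
    exact ⟨n, hn, j, _, ⟨hpU, F.maps_inv.iterate n (add_int_mem_Ann hpA j)⟩,
      F.iterate_right_inv n (add_int_mem_Ann hpA j)⟩
  have hbelow : IsOpen {p : ℝ × ℝ | p.2 < φ₂ p.1} :=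
    isOpen_lt continuous_snd (hφ₂.continuous.comp continuous_fst)
  obtain ⟨δ, hδ, hsub⟩ := ((isCompact_Icc (a := (0 : ℝ)) (b := 1)).image hgc
    ).exists_thickening_subset_open (isOpen_interior.inter hbelow)
      (by rintro _ ⟨x, -, rfl⟩; exact ⟨hP x, hlt x⟩)
  have key : ∀ x ∈ Icc (0 : ℝ) 1, (x, φ x + δ / 2) ∈ P ∧ φ x + δ / 2 < φ₂ x := by
    intro x hx
    have h1 : (x, φ x + δ / 2) ∈ Metric.thickening δ ((fun x => (x, φ x)) '' Icc (0 : ℝ) 1) := by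
      refine Metric.mem_thickening_iff.2 ⟨_, mem_image_of_mem _ hx, ?_⟩
      simp [Prod.dist_eq, abs_of_pos hδ, hδ]
    exact ⟨interior_subset (hsub h1).1, (hsub h1).2⟩
  have hfr : ∀ x : ℝ, Int.fract x ∈ Icc (0 : ℝ) 1 := fun x =>
    ⟨Int.fract_nonneg x, (Int.fract_lt_one x).le⟩
  have hφf : ∀ x, φ (Int.fract x) = φ x := fun x => by
    rw [← hφ.apply_add_int (Int.fract x) ⌊x⌋, Int.fract_add_floor]
  have hφ₂f : ∀ x, φ₂ (Int.fract x) = φ₂ x := fun x => by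
    rw [← hφ₂.apply_add_int (Int.fract x) ⌊x⌋, Int.fract_add_floor]
  refine ⟨δ / 2, by linarith, fun x => ?_, fun x => ?_⟩
  · have := (key _ (hfr x)).2
    rwa [hφf, hφ₂f] at this
  · obtain ⟨h1, h2⟩ := key _ (hfr x)
    obtain ⟨n, hn, j, u, hu, e⟩ := h1
      ⟨by linarith [(hφ.2.1 (Int.fract x)).1], h2.le.trans (hφ₂.2.1 _).2⟩
    refine ⟨n, hn, j - ⌊x⌋, u, hu, ?_⟩
    rw [e, hφf]
    ext <;> simp
    linarith [Int.fract_add_floor x]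

end IsPrimaryTorusFn

/-- A translation invariant region of the annulus that contains the bottom and does not rise
steeply to the right. -/
structure IsRegion (K : ℝ) (L : Set (ℝ × ℝ)) : Prop where
  subset_Ann : L ⊆ Ann
  bot : ∀ x, (x, (0 : ℝ)) ∈ L
  downLeft : DownLeftClosed K L
  shift : ShiftInvariant L

namespace IsRegion

variable {K : ℝ} {L : Set (ℝ × ℝ)}

lemma shadow {f g : ℝ × ℝ → ℝ × ℝ} {c C : ℝ} (h : IsTwistPair f g c C) (hs : CommutesWithShift f)
    (hK : C / c ≤ K) (hL : IsRegion K L) : IsRegion K (shadow f L) where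
  subset_Ann := h.shadow_subset hL.subset_Ann
  bot x := h.image_subset_shadow hL.subset_Ann <| (h.mem_image hL.subset_Ann).2
    ⟨hL.subset_Ann (hL.bot x), by
      rw [show g (x, 0) = ((g (x, 0)).1, 0) from Prod.ext rfl (h.bot_inv x)]
      exact hL.bot _⟩
  downLeft x x' y y' hy' hx hy hle :=
    h.downLeftClosed_shadow hL.subset_Ann hL.downLeft.isLowerRegion x x' y y' hy' hx hy <| by
      have := mul_le_mul_of_nonneg_right hK (sub_nonneg.2 hx)
      linarith
  shift := by
    rintro ⟨x, y⟩ ⟨h0, y', hy, q, hq, e⟩ j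
    refine ⟨by simpa using h0, y', by simpa using hy, _, hL.shift q hq j, ?_⟩
    rw [hs q (hL.subset_Ann hq), e]
    simp

lemma shadow_iterate {f g : ℝ × ℝ → ℝ × ℝ} {c C : ℝ} (h : IsTwistPair f g c C)
    (hs : CommutesWithShift f) (hK : C / c ≤ K) (hL : IsRegion K L) (n : ℕ) :
    IsRegion K ((_root_.shadow f)^[n] L) := by
  induction n with
  | zero => exact hL
  | succ n ih =>
    rw [Function.iterate_succ_apply']
    exact ih.shadow h hs hK

lemma iUnion {ι : Type*} [Nonempty ι] {L : ι → Set (ℝ × ℝ)} (hL : ∀ i, IsRegion K (L i)) :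
    IsRegion K (⋃ i, L i) where
  subset_Ann := iUnion_subset fun i => (hL i).subset_Ann
  bot x := mem_iUnion.2 ⟨Classical.arbitrary ι, (hL _).bot x⟩
  downLeft x x' y y' hy' hx hy hle := by
    obtain ⟨i, hi⟩ := mem_iUnion.1 hy'
    exact mem_iUnion.2 ⟨i, (hL i).downLeft x x' y y' hi hx hy hle⟩
  shift p hp j := by
    obtain ⟨i, hi⟩ := mem_iUnion.1 hp
    exact mem_iUnion.2 ⟨i, (hL i).shift p hi j⟩

lemma closure (hL : IsRegion K L) : IsRegion K (closure L) where
  subset_Ann := closure_minimal hL.subset_Ann isClosed_Ann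
  bot x := subset_closure (hL.bot x)
  downLeft x x' y y' hy' hx hy hle := by
    have hm := map_mem_closure (t := L)
      (f := fun q : ℝ × ℝ => (q.1 - x' + x, max 0 (q.2 - y' + y))) (by fun_prop) hy'
      fun q hq => by
        dsimp only
        rcases le_total (q.2 - y' + y) 0 with h0 | h0
        · rw [max_eq_left h0]
          exact hL.bot _
        · rw [max_eq_right h0]
          refine hL.downLeft _ q.1 _ q.2 hq (by linarith) h0 ?_
          have : q.1 - (q.1 - x' + x) = x' - x := by ring
          rw [this]
          linarith
    simpa [hy] using hm
  shift p hp j := map_mem_closure (f := fun q => q + ((j : ℝ), (0 : ℝ))) (by fun_prop) hp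
    fun q hq => hL.shift q hq j

lemma exists_open_subset (hK : 0 ≤ K) (hL : IsRegion K L) {p : ℝ × ℝ} (hp : p ∈ L) (h0 : 0 < p.2)
    {W : Set (ℝ × ℝ)} (hW : W ∈ 𝓝 p) : ∃ E ⊆ L ∩ W, IsOpen E ∧ E.Nonempty := by
  obtain ⟨x, y⟩ := p
  dsimp only at h0
  obtain ⟨r, hr, hsub⟩ := Metric.mem_nhds_iff.1 hW
  refine ⟨Metric.ball (x, y) r ∩ {q | q.1 < x ∧ 0 < q.2 ∧ q.2 + K * (x - q.1) < y}, ?_, ?_, ?_⟩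
  · rintro ⟨a, b⟩ ⟨hb, h1, h2, h3⟩
    exact ⟨hL.downLeft a x b y hp h1.le h2.le h3.le, hsub hb⟩
  · exact Metric.isOpen_ball.inter ((isOpen_lt (by fun_prop) (by fun_prop)).and
      ((isOpen_lt (by fun_prop) (by fun_prop)).and (isOpen_lt (by fun_prop) (by fun_prop))))
  · have hm : 0 < min y r := lt_min h0 hr
    set t := min y r / (2 * (K + 1)) with ht
    have ht0 : 0 < t := by positivity
    have ht1 : (K + 1) * t = min y r / 2 := by
      rw [ht]
      field_simp
    have hy : min y r ≤ y := min_le_left _ _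
    have hr' : min y r ≤ r := min_le_right _ _
    have hKt : 0 ≤ K * t := by positivity
    refine ⟨(x - t, y - (K + 1) * t), ?_, ?_, ?_, ?_⟩
    · rw [Metric.mem_ball, Prod.dist_eq, max_lt_iff, Real.dist_eq, Real.dist_eq]
      constructor <;> rw [abs_lt] <;> constructor <;> dsimp only <;> linarith
    · simpa using ht0
    · dsimp only
      linarith
    · dsimp only
      have : x - (x - t) = t := by ring
      rw [this]
      linarith

/-- A forward invariant region has invariant closure, by preservation of area. -/
lemma image_closure_eq (F : AnnulusTwistMap) (hK : 0 ≤ K) (hL : IsRegion K L)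
    (hm : MeasurableSet L) (hf : F.f '' L ⊆ L) : F.f '' _root_.closure L = _root_.closure L := by
  obtain ⟨c, C, h⟩ := F.isTwistPair
  apply Subset.antisymm
  · exact (h.continuousOn.mono hL.closure.subset_Ann).image_closure.trans (closure_mono hf)
  · have hcl := h.isClosed_image hL.closure.subset_Ann isClosed_closure
    refine closure_minimal (fun p hp => ?_) hcl
    by_contra hpn
    rcases (hL.subset_Ann hp).1.eq_or_lt with h0 | h0
    · refine hpn ((h.mem_image hL.closure.subset_Ann).2 ⟨hL.subset_Ann hp, subset_closure ?_⟩)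
      have e : F.finv p = ((F.finv p).1, 0) := Prod.ext rfl (by
        rw [show p = (p.1, 0) from Prod.ext rfl h0.symm]
        exact h.bot_inv _)
      rw [e]
      exact hL.bot _
    · obtain ⟨E, hE, hEo, hEn⟩ := hL.exists_open_subset hK hp h0 (hcl.isOpen_compl.mem_nhds hpn)
      refine (hEo.measure_pos MeasureTheory.volume hEn).ne'
        (MeasureTheory.measure_mono_null (fun q hq => ?_)
          (F.volume_diff_image_eq_zero hL.subset_Ann hm hL.shift hf))
      exact ⟨(hE hq).1, fun hq' => (hE hq).2 (image_mono subset_closure hq')⟩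

end IsRegion

namespace IsTwistPair

variable {f g : ℝ × ℝ → ℝ × ℝ} {c C : ℝ}

lemma isClosed_shadow_iterate (h : IsTwistPair f g c C) (hs : CommutesWithShift f) {K : ℝ}
    (hK : C / c ≤ K) {L : Set (ℝ × ℝ)} (hL : IsRegion K L) (hc : IsClosed L) (n : ℕ) :
    IsClosed ((shadow f)^[n] L) := by
  induction n with
  | zero => exact hc
  | succ n ih =>
    rw [Function.iterate_succ_apply']
    exact h.isClosed_shadow (hL.shadow_iterate h hs hK n).subset_Ann ih

lemma topSet_shadow_iterate_subset (h : IsTwistPair f g c C) (hs : CommutesWithShift f) {K : ℝ}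
    (hK : C / c ≤ K) {L : Set (ℝ × ℝ)} (hL : IsRegion K L) (n : ℕ) :
    topSet ((shadow f)^[n] L) ⊆ f^[n] '' topSet L := by
  have hK0 : 0 ≤ K := (div_nonneg h.C_nonneg h.c_pos.le).trans hK
  induction n with
  | zero => simp
  | succ n ih =>
    have hn := hL.shadow_iterate h hs hK n
    rw [Function.iterate_succ_apply', Function.iterate_succ', image_comp]
    exact (h.topSet_shadow_subset hn.subset_Ann hK0 hn.downLeft).trans (image_mono ih)

lemma image_iUnion_shadow_subset (h : IsTwistPair f g c C) (hs : CommutesWithShift f) {K : ℝ}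
    (hK : C / c ≤ K) {L : Set (ℝ × ℝ)} (hL : IsRegion K L) :
    f '' (⋃ n, (shadow f)^[n] L) ⊆ ⋃ n, (shadow f)^[n] L := by
  rw [image_iUnion]
  refine iUnion_subset fun n => subset_iUnion_of_subset (n + 1) ?_
  rw [Function.iterate_succ_apply']
  exact h.image_subset_shadow (hL.shadow_iterate h hs hK n).subset_Ann

end IsTwistPair

/-- The upper boundary of an invariant closed region is an invariant primary torus. -/
lemma AnnulusTwistMap.exists_primaryTorus_of_invariant (F : AnnulusTwistMap) {K : ℝ} (hK : 0 ≤ K)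
    {L : Set (ℝ × ℝ)} (hL : IsRegion K L) (hc : IsClosed L) (hf : F.f '' L = L) :
    ∃ ψ, IsPrimaryTorusFn F ψ ∧ ∀ x y, (x, y) ∈ L ↔ 0 ≤ y ∧ y ≤ ψ x := by
  obtain ⟨c, C, h⟩ := F.isTwistPair
  obtain ⟨ψ, hlip, hmem, hinv⟩ :=
    h.exists_graph_of_invariant hL.subset_Ann hc hK hL.downLeft hL.bot hf
  have h0 : ∀ x, 0 ≤ ψ x := fun x => ((hmem x 0).1 (hL.bot x)).2
  have hψ : ∀ x, (x, ψ x) ∈ L := fun x => (hmem x _).2 ⟨h0 x, le_rfl⟩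
  have hle : ∀ x (j : ℤ), ψ x ≤ ψ (x + j) := fun x j =>
    ((hmem _ _).1 (by simpa using hL.shift _ (hψ x) j)).2
  refine ⟨ψ, ⟨hlip, fun x => hL.subset_Ann (hψ x), fun x => le_antisymm ?_ ?_, hinv⟩, hmem⟩
  · simpa using hle (x + 1) (-1)
  · simpa using hle x 1

/-- The region below an upward translate of an invariant torus is a region in the above sense. -/
lemma IsPrimaryTorusFn.exists_isRegion_add {F : AnnulusTwistMap} {φ : ℝ → ℝ}
    (hφ : IsPrimaryTorusFn F φ) {ε : ℝ} (hε : 0 ≤ ε) (h1 : ∀ x, φ x + ε ≤ 1) (K₀ : ℝ) :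
    ∃ K ≥ K₀, IsRegion K {p | 0 ≤ p.2 ∧ p.2 ≤ φ p.1 + ε} := by
  obtain ⟨K₁, hK₁⟩ := hφ.1
  refine ⟨max K₀ K₁, le_max_left _ _, fun p hp => ⟨hp.1, hp.2.trans (h1 _)⟩,
    fun x => ⟨le_rfl, add_nonneg (hφ.2.1 x).1 hε⟩, ?_, ?_⟩
  · rintro x x' y y' ⟨-, hy'⟩ hx hy hle
    refine ⟨hy, ?_⟩
    have h2 := hK₁.le_add_mul x' x
    rw [Real.dist_eq, abs_of_nonneg (sub_nonneg.2 hx)] at h2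
    have h3 := mul_le_mul_of_nonneg_right (le_max_right K₀ K₁) (sub_nonneg.2 hx)
    dsimp only at hy' ⊢
    linarith
  · rintro p ⟨h2, h3⟩ j
    refine ⟨by simpa using h2, ?_⟩
    simpa [hφ.apply_add_int] using h3

/-- The shadows of a region below an invariant torus stay below it. -/
lemma IsPrimaryTorusFn.shadow_iterate_subset {F : AnnulusTwistMap} {φ : ℝ → ℝ}
    (hφ : IsPrimaryTorusFn F φ) {L : Set (ℝ × ℝ)} (hL : L ⊆ {p | 0 ≤ p.2 ∧ p.2 ≤ φ p.1}) (n : ℕ) :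
    (shadow F.f)^[n] L ⊆ {p | 0 ≤ p.2 ∧ p.2 ≤ φ p.1} := by
  induction n with
  | zero => exact hL
  | succ n ih =>
    rw [Function.iterate_succ_apply']
    rintro ⟨x, y⟩ ⟨h0, y', hy, q, hq, e⟩
    have := hφ.map_below (ih hq).1 (ih hq).2
    rw [Prod.mk.eta, e] at this
    exact ⟨h0, hy.trans this⟩

/-- **Corollary 4.2**: if the invariant primary tori `T₁ = graph φ₁` and `T₂ = graph φ₂`
bound a Birkhoff Zone of Instability and the restriction of `f` to each of `T₁`, `T₂` is
topologically transitive in the quotient annulus, then for every `ζ₁ ∈ T₁`, `ζ₂ ∈ T₂`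
and open neighborhoods `U ∋ ζ₁`, `V ∋ ζ₂` in `A` there exist `z ∈ U`, `N > 0` and `j ∈ ℤ`
with `f^N(z) ∈ V + (j,0)`. -/
theorem birkhoff_connecting_points (F : AnnulusTwistMap) (φ₁ φ₂ : ℝ → ℝ)
    (hZ : IsBZI F φ₁ φ₂)
    (htrans₁ : TransitiveOnTorus F φ₁) (htrans₂ : TransitiveOnTorus F φ₂)
    (ζ₁ ζ₂ : ℝ × ℝ) (hζ₁ : ζ₁ ∈ torusGraph φ₁) (hζ₂ : ζ₂ ∈ torusGraph φ₂)
    (U V : Set (ℝ × ℝ))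
    (hU : ∃ U₀, IsOpen U₀ ∧ U = U₀ ∩ Ann) (hV : ∃ V₀, IsOpen V₀ ∧ V = V₀ ∩ Ann)
    (hζU : ζ₁ ∈ U) (hζV : ζ₂ ∈ V) :
    ∃ z ∈ U, ∃ N : ℕ, 0 < N ∧ ∃ j : ℤ, ∃ v ∈ V, (F.f)^[N] z = v + ((j : ℝ), 0) := by
  obtain ⟨hφ₁, hφ₂, hlt, hinst⟩ := hZ
  obtain ⟨U₀, hU₀, rfl⟩ := hU
  obtain ⟨V₀, hV₀, rfl⟩ := hV
  obtain ⟨ε, hε, hεlt, hreach⟩ := hφ₁.exists_height htrans₁ hφ₂ hlt hζ₁ hU₀ hζU.1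
  obtain ⟨c, C, h⟩ := F.isTwistPair
  have hs := F.commutesWithShift
  obtain ⟨K, hK, hL⟩ := hφ₁.exists_isRegion_add hε.le
    (fun x => (hεlt x).le.trans (hφ₂.2.1 x).2) (C / c)
  have hK0 : 0 ≤ K := (div_nonneg h.C_nonneg h.c_pos.le).trans hK
  set L : Set (ℝ × ℝ) := {p | 0 ≤ p.2 ∧ p.2 ≤ φ₁ p.1 + ε}
  have hLc : IsClosed L := (isClosed_le continuous_const continuous_snd).and
    (isClosed_le continuous_snd ((hφ₁.continuous.comp continuous_fst).add continuous_const))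
  have hLn := hL.shadow_iterate h hs hK
  have hLnc := h.isClosed_shadow_iterate hs hK hL hLc
  have hbelow := hφ₂.shadow_iterate_subset
    (show L ⊆ _ from fun p hp => ⟨hp.1, hp.2.trans (hεlt _).le⟩)
  have hM := IsRegion.iUnion hLn
  have hinv := hM.image_closure_eq F hK0 (.iUnion fun n => (hLnc n).measurableSet)
    (h.image_iUnion_shadow_subset hs hK hL)
  set M := ⋃ n, (shadow F.f)^[n] L
  obtain ⟨ψ, hψ, hmem⟩ := F.exists_primaryTorus_of_invariant hK0 hM.closure isClosed_closure hinv
  have hMφ₂ : closure M ⊆ {p | p.2 ≤ φ₂ p.1} :=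
    closure_minimal (iUnion_subset fun n p hp => (hbelow n hp).2)
      (isClosed_le continuous_snd (hφ₂.continuous.comp continuous_fst))
  have hψφ₂ : ∀ x, ψ x ≤ φ₂ x := fun x => hMφ₂ ((hmem x (ψ x)).2 ⟨(hψ.2.1 x).1, le_rfl⟩)
  have hφ₁ψ : ∀ x, φ₁ x < ψ x := fun x => by
    have h1 : (x, φ₁ x + ε) ∈ closure M := subset_closure <| mem_iUnion.2
      ⟨0, by linarith [(hφ₁.2.1 x).1], le_rfl⟩
    linarith [((hmem _ _).1 h1).2]
  obtain rfl : ψ = φ₂ := by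
    obtain ⟨⟨x, y⟩, hy, hxy⟩ := not_subset.1 (hinst _ ⟨ψ, hψ, rfl⟩)
    obtain rfl : y = ψ x := hy
    exact hψ.eq_of_transitive hφ₂ htrans₂
      (le_antisymm (hψφ₂ x) (not_lt.1 fun hlt => hxy ⟨hφ₁ψ x, hlt⟩))
  obtain ⟨x₂, y₂⟩ := ζ₂
  obtain rfl : y₂ = ψ x₂ := hζ₂
  obtain ⟨δ, hδ, hball⟩ := Metric.isOpen_iff.1 hV₀ _ hζV.1
  obtain ⟨δ', hδ', hcont⟩ := Metric.continuous_iff.1 hψ.continuous x₂ δ hδ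
  obtain ⟨⟨x, y⟩, hxy, hd⟩ := Metric.mem_closure_iff.1
    ((hmem x₂ (ψ x₂)).2 ⟨(hψ.2.1 x₂).1, le_rfl⟩) (min δ δ') (lt_min hδ hδ')
  obtain ⟨n, hn⟩ := mem_iUnion.1 hxy
  rw [dist_comm, Prod.dist_eq, max_lt_iff, lt_min_iff, lt_min_iff] at hd
  obtain ⟨y', hy'n, hy'⟩ := (isCompact_Icc.of_isClosed_subset
    ((hLnc n).preimage (by fun_prop : Continuous fun y => (x, y)))
    fun y hy => (hLn n).subset_Ann hy).exists_isGreatest ⟨y, hn⟩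
  have hyy' : y ≤ y' := hy' hn
  have hy'ψ : y' ≤ ψ x := (hbelow n hy'n).2
  have hV : (x, y') ∈ V₀ := by
    refine hball ?_
    rw [Metric.mem_ball, Prod.dist_eq, max_lt_iff]
    refine ⟨hd.1.1, ?_⟩
    have h1 := hcont x hd.1.2
    have h2 := hd.2.1
    rw [Real.dist_eq, abs_lt] at h1 h2 ⊢
    constructor <;> dsimp only at * <;> linarith
  obtain ⟨⟨s, t⟩, hst, e⟩ := h.topSet_shadow_iterate_subset hs hK hL n ⟨hy'n, fun b hb => hy' hb⟩
  obtain rfl : t = φ₁ s + ε := le_antisymm hst.1.2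
    (hst.2 _ ⟨add_nonneg (hφ₁.2.1 s).1 hε.le, le_rfl⟩)
  obtain ⟨k, hk, j, u, hu, hku⟩ := hreach s
  refine ⟨u, hu, n + k, by omega, j, (x, y'), ⟨hV, (hLn n).subset_Ann hy'n⟩, ?_⟩
  rw [Function.iterate_add_apply, hku, hs.iterate F.maps n _ (hL.subset_Ann hst.1), e]
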